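/- Let H ∈ (1/2,1), T > 0, x ∈ ℝ and α < 1/2 − 1/(2H). Then the series ∑_{n=0}^∞ (n+2)^α · n! · ∫_0^T ∫_0^T |u−v|^{2H−2} R(u,v)^n (uv)^{−Hn} p_{u^{2H}}(x) p_{v^{2H}}(x) |H_n(x u^{−H}) H_n(x v^{−H})| du dv converges (is finite). (This is the diagonal part A(n) of the Sobolev–Watanabe norm computation for the fractional Brownian current ξ(x) = ∫_0^T δ(x−B^H_s) dB^H_s.) -/

import Mathlib

open MeasureTheory Real

/-- The centered Gaussian density of variance `s`: `p_s(x) = (2πs)^{-1/2} exp(−x²/(2s))`. -/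
noncomputable def gaussianKernel (s x : ℝ) : ℝ :=
  (Real.sqrt (2 * Real.pi * s))⁻¹ * Real.exp (-x ^ 2 / (2 * s))

/-- The normalized Hermite polynomial
`H_n(x) = ((−1)^n/n!) e^{x²/2} (d^n/dx^n) e^{−x²/2}`. -/
noncomputable def hermiteH (n : ℕ) (x : ℝ) : ℝ :=
  ((-1) ^ n / n.factorial) * Real.exp (x ^ 2 / 2) *
    iteratedDeriv n (fun y => Real.exp (-y ^ 2 / 2)) x

/-- The covariance function of fractional Brownian motion with Hurst parameter `H`:
`R(t,s) = (1/2)(t^{2H}+s^{2H}−|t−s|^{2H})`. -/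
noncomputable def fbmCov (H t s : ℝ) : ℝ :=
  (t ^ (2 * H) + s ^ (2 * H) - |t - s| ^ (2 * H)) / 2

/-- The `n`-th derivative of the unnormalized standard Gaussian density `e^{-y²/2}`. -/
noncomputable def gaussDeriv (n : ℕ) (y : ℝ) : ℝ :=
  iteratedDeriv n (fun y => Real.exp (-y ^ 2 / 2)) y

theorem hasDerivAt_gaussDeriv (n : ℕ) (y : ℝ) :
    HasDerivAt (gaussDeriv n) (gaussDeriv (n + 1) y) y := by
  have hc : ContDiff ℝ ⊤ (fun y : ℝ => Real.exp (-y ^ 2 / 2)) := by fun_prop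
  have hd : Differentiable ℝ (gaussDeriv n) := hc.differentiable_iteratedDeriv n (by simp)
  have := (hd y).hasDerivAt
  rwa [show deriv (gaussDeriv n) y = gaussDeriv (n + 1) y from
    (congrFun iteratedDeriv_succ y).symm] at this

theorem gaussDeriv_zero (y : ℝ) : gaussDeriv 0 y = Real.exp (-y ^ 2 / 2) := by
  simp [gaussDeriv]

theorem gaussDeriv_one (y : ℝ) : gaussDeriv 1 y = -y * gaussDeriv 0 y := by
  have h1 : HasDerivAt (gaussDeriv 0) (-y * gaussDeriv 0 y) y := by
    have h : HasDerivAt (fun y : ℝ => Real.exp (-y ^ 2 / 2))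
        (Real.exp (-y ^ 2 / 2) * (-(2 * y) / 2)) y := by
      have := (((hasDerivAt_id y).pow 2).neg.div_const 2).exp
      convert this using 1 <;> simp
    rw [gaussDeriv_zero]
    convert h using 1
    · funext z; exact gaussDeriv_zero z
    · ring
  exact (hasDerivAt_gaussDeriv 0 y).unique h1

theorem gaussDeriv_add_two (n : ℕ) (y : ℝ) :
    gaussDeriv (n + 2) y = -y * gaussDeriv (n + 1) y - (n + 1) * gaussDeriv n y := by
  induction n generalizing y with
  | zero =>
    have h : HasDerivAt (gaussDeriv 1) (-1 * gaussDeriv 0 y + -y * gaussDeriv 1 y) y := by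
      have := (hasDerivAt_id y).neg.mul (hasDerivAt_gaussDeriv 0 y)
      exact this.congr_of_eventuallyEq (.of_forall fun z => gaussDeriv_one z)
    rw [(hasDerivAt_gaussDeriv 1 y).unique h]
    push_cast; ring
  | succ n ih =>
    have h : HasDerivAt (gaussDeriv (n + 2)) ((-1 * gaussDeriv (n + 1) y +
        -y * gaussDeriv (n + 2) y) - (n + 1) * gaussDeriv (n + 1) y) y := by
      have := ((hasDerivAt_id y).neg.mul (hasDerivAt_gaussDeriv (n + 1) y)).sub
        ((hasDerivAt_gaussDeriv n y).const_mul ((n : ℝ) + 1))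
      exact this.congr_of_eventuallyEq (.of_forall fun z => ih z)
    rw [(hasDerivAt_gaussDeriv (n + 2) y).unique h]
    push_cast; ring

/-- The energy of the solution `gaussDeriv n` of `f'' + y f' + (n + 1) f = 0`. -/
noncomputable def gaussEnergy (n : ℕ) (y : ℝ) : ℝ :=
  gaussDeriv (n + 1) y ^ 2 + (n + 1) * gaussDeriv n y ^ 2

theorem hasDerivAt_gaussEnergy (n : ℕ) (y : ℝ) :
    HasDerivAt (gaussEnergy n) (-2 * y * gaussDeriv (n + 1) y ^ 2) y := by
  have := ((hasDerivAt_gaussDeriv (n + 1) y).pow 2).add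
    (((hasDerivAt_gaussDeriv n y).pow 2).const_mul ((n : ℝ) + 1))
  refine this.congr_deriv ?_
  rw [gaussDeriv_add_two]
  push_cast; ring

theorem gaussEnergy_le_zero (n : ℕ) (y : ℝ) : gaussEnergy n y ≤ gaussEnergy n 0 := by
  have hd : Differentiable ℝ (gaussEnergy n) := fun z =>
    (hasDerivAt_gaussEnergy n z).differentiableAt
  rcases le_total 0 y with hy | hy
  · refine antitoneOn_of_deriv_nonpos (convex_Ici 0) hd.continuous.continuousOn
      hd.differentiableOn (fun z hz => ?_) (Set.mem_Ici.2 le_rfl) (Set.mem_Ici.2 hy) hy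
    rw [interior_Ici, Set.mem_Ioi] at hz
    rw [(hasDerivAt_gaussEnergy n z).deriv]
    nlinarith [mul_nonneg hz.le (sq_nonneg (gaussDeriv (n + 1) z))]
  · refine monotoneOn_of_deriv_nonneg (convex_Iic 0) hd.continuous.continuousOn
      hd.differentiableOn (fun z hz => ?_) (Set.mem_Iic.2 hy) (Set.mem_Iic.2 le_rfl) hy
    rw [interior_Iic, Set.mem_Iio] at hz
    rw [(hasDerivAt_gaussEnergy n z).deriv]
    nlinarith [mul_nonneg (neg_nonneg.2 hz.le) (sq_nonneg (gaussDeriv (n + 1) z))]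

theorem gaussEnergy_add_two_zero_le (n : ℕ) :
    gaussEnergy (n + 2) 0 ≤ ((n : ℝ) + 2) ^ 2 * gaussEnergy n 0 := by
  have h3 : gaussDeriv (n + 3) 0 = -(n + 2) * gaussDeriv (n + 1) 0 := by
    rw [gaussDeriv_add_two (n + 1)]; push_cast; ring
  have h2 : gaussDeriv (n + 2) 0 = -(n + 1) * gaussDeriv n 0 := by
    rw [gaussDeriv_add_two n]; ring
  have hn : (0 : ℝ) ≤ n := n.cast_nonneg
  unfold gaussEnergy
  rw [h3, h2]
  push_cast
  nlinarith [mul_nonneg (by linarith : (0 : ℝ) ≤ n + 1) (sq_nonneg (gaussDeriv n 0))]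

theorem gaussEnergy_succ_zero_le (n : ℕ) :
    gaussEnergy (n + 1) 0 ≤ 3 * (n + 1).factorial * √(n + 1) := by
  induction n using Nat.twoStepInduction with
  | zero =>
    have h0 : gaussDeriv 0 0 = 1 := by simp [gaussDeriv_zero]
    have h1 : gaussDeriv 1 0 = 0 := by simp [gaussDeriv_one]
    have h2 : gaussDeriv 2 0 = -1 := by simp [gaussDeriv_add_two 0, h0]
    norm_num [gaussEnergy, h1, h2]
  | one =>
    have h0 : gaussDeriv 0 0 = 1 := by simp [gaussDeriv_zero]
    have h1 : gaussDeriv 1 0 = 0 := by simp [gaussDeriv_one]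
    have h2 : gaussDeriv 2 0 = -1 := by simp [gaussDeriv_add_two 0, h0]
    have h3 : gaussDeriv 3 0 = 0 := by simp [gaussDeriv_add_two 1, h1]
    have : (1 : ℝ) ≤ √2 := Real.one_le_sqrt.2 (by norm_num)
    norm_num [gaussEnergy, h3, h2]
    linarith
  | more n ih _ =>
    have h := gaussEnergy_add_two_zero_le (n + 1)
    have hn : (0 : ℝ) ≤ n := n.cast_nonneg
    have key : ((n : ℝ) + 3) * √(n + 1) ≤ (n + 2) * √(n + 3) := by
      refine abs_le_of_sq_le_sq' ?_ (by positivity) |>.2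
      rw [mul_pow, mul_pow, Real.sq_sqrt (by positivity), Real.sq_sqrt (by positivity)]
      nlinarith
    have hf : (((n + 2 + 1).factorial : ℕ) : ℝ) = (n + 3) * ((n + 2) * (n + 1).factorial) := by
      rw [Nat.factorial_succ (n + 2), Nat.factorial_succ (n + 1)]; push_cast; ring
    have hs : (((n + 2 : ℕ) : ℝ) + 1) = n + 3 := by push_cast; ring
    calc gaussEnergy (n + 2 + 1) 0 ≤ ((n : ℝ) + 3) ^ 2 * gaussEnergy (n + 1) 0 := by
          convert h using 3; push_cast; ring
      _ ≤ ((n : ℝ) + 3) ^ 2 * (3 * (n + 1).factorial * √(n + 1)) := by gcongr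
      _ = 3 * ((n + 3) * (n + 1).factorial) * (((n : ℝ) + 3) * √(n + 1)) := by ring
      _ ≤ 3 * ((n + 3) * (n + 1).factorial) * ((n + 2) * √(n + 3)) := by gcongr
      _ = _ := by rw [hf, hs]; ring

theorem gaussEnergy_zero_le (n : ℕ) :
    gaussEnergy n 0 ≤ 3 * n.factorial * √(n + 1) := by
  cases n with
  | zero => norm_num [gaussEnergy, gaussDeriv_one, gaussDeriv_zero]
  | succ n =>
    refine (gaussEnergy_succ_zero_le n).trans ?_
    gcongr
    linarith

theorem gaussDeriv_sq_le (n : ℕ) (y : ℝ) :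
    gaussDeriv n y ^ 2 ≤ 12 * n.factorial * ((n : ℝ) + 1) ^ (-(1 / 2) : ℝ) := by
  have h : gaussEnergy n y ≤ _ := (gaussEnergy_le_zero n y).trans (gaussEnergy_zero_le n)
  have hn : (0 : ℝ) < n + 1 := by positivity
  have h1 : ((n : ℝ) + 1) * gaussDeriv n y ^ 2 ≤ 3 * n.factorial * √(n + 1) := by
    refine le_trans ?_ h
    unfold gaussEnergy
    nlinarith [sq_nonneg (gaussDeriv (n + 1) y)]
  rw [Real.rpow_neg hn.le, ← Real.sqrt_eq_rpow, ← div_eq_mul_inv, le_div_iff₀ (by positivity)]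
  have hs : √((n : ℝ) + 1) * √((n : ℝ) + 1) = n + 1 := Real.mul_self_sqrt hn.le
  have hs0 : 0 < √((n : ℝ) + 1) := by positivity
  have hf : (0 : ℝ) < n.factorial := by positivity
  have : √((n : ℝ) + 1) * (gaussDeriv n y ^ 2 * √(n + 1)) ≤
      √((n : ℝ) + 1) * (3 * n.factorial) := by
    calc _ = ((n : ℝ) + 1) * gaussDeriv n y ^ 2 := by linear_combination gaussDeriv n y ^ 2 * hs
      _ ≤ _ := h1
      _ = _ := by ring
  have := le_of_mul_le_mul_left this hs0
  linarith

theorem sq_mul_gaussDeriv_sq_le (n : ℕ) (y : ℝ) :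
    y ^ 2 * gaussDeriv n y ^ 2 ≤ 12 * n.factorial * ((n : ℝ) + 1) ^ (1 / 2 : ℝ) := by
  rw [← Real.sqrt_eq_rpow]
  have h1 : gaussDeriv (n + 1) y ^ 2 ≤ 3 * n.factorial * √(n + 1) := by
    refine le_trans ?_ ((gaussEnergy_le_zero n y).trans (gaussEnergy_zero_le n))
    unfold gaussEnergy
    have : 0 ≤ ((n : ℝ) + 1) * gaussDeriv n y ^ 2 := by positivity
    linarith
  cases n with
  | zero =>
    have : y ^ 2 * gaussDeriv 0 y ^ 2 = gaussDeriv (0 + 1) y ^ 2 := by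
      rw [zero_add, gaussDeriv_one]; ring
    rw [this]
    refine h1.trans ?_
    norm_num
  | succ n =>
    have h2 : ((n : ℝ) + 1) * gaussDeriv n y ^ 2 ≤ 3 * n.factorial * √(n + 1) := by
      refine le_trans ?_ ((gaussEnergy_le_zero n y).trans (gaussEnergy_zero_le n))
      unfold gaussEnergy
      nlinarith [sq_nonneg (gaussDeriv (n + 1) y)]
    have h3 : (((n : ℝ) + 1) * gaussDeriv n y) ^ 2 ≤
        3 * (n + 1).factorial * √((n + 1 : ℕ) + 1) := by
      calc _ = ((n : ℝ) + 1) * (((n : ℝ) + 1) * gaussDeriv n y ^ 2) := by ring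
        _ ≤ ((n : ℝ) + 1) * (3 * n.factorial * √(n + 1)) := by gcongr
        _ = 3 * (n + 1).factorial * √(n + 1) := by
          rw [Nat.factorial_succ]; push_cast; ring
        _ ≤ _ := by gcongr; linarith
    have h4 : y * gaussDeriv (n + 1) y =
        -gaussDeriv (n + 2) y - ((n : ℝ) + 1) * gaussDeriv n y := by
      rw [gaussDeriv_add_two]; ring
    rw [← mul_pow, h4]
    nlinarith [sq_nonneg (gaussDeriv (n + 2) y - ((n : ℝ) + 1) * gaussDeriv n y)]

theorem abs_rpow_mul_abs_gaussDeriv_le (n : ℕ) (y : ℝ) {ε : ℝ} (h0 : 0 ≤ ε) (h1 : ε ≤ 1) :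
    |y| ^ ε * |gaussDeriv n y| ≤ √(12 * n.factorial * ((n : ℝ) + 1) ^ (ε - 1 / 2)) := by
  apply Real.le_sqrt_of_sq_le
  have hn : (0 : ℝ) < n + 1 := by positivity
  set g := gaussDeriv n y ^ 2 with hg
  have hg0 : 0 ≤ g := sq_nonneg _
  have hF : (0 : ℝ) ≤ 12 * n.factorial := by positivity
  calc (|y| ^ ε * |gaussDeriv n y|) ^ 2 = g ^ (1 - ε) * (y ^ 2 * g) ^ ε := by
        rw [Real.mul_rpow (sq_nonneg _) hg0, mul_left_comm, ← Real.rpow_add' hg0 (by simp)]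
        rw [mul_pow, sq_abs, ← sq_abs y, ← Real.rpow_mul_natCast (abs_nonneg _),
          ← Real.rpow_natCast_mul (abs_nonneg _), mul_comm ε]
        simp [hg]
    _ ≤ (12 * n.factorial * ((n : ℝ) + 1) ^ (-(1 / 2) : ℝ)) ^ (1 - ε) *
        (12 * n.factorial * ((n : ℝ) + 1) ^ (1 / 2 : ℝ)) ^ ε := by
        refine mul_le_mul ?_ ?_ (by positivity) (by positivity)
        · exact Real.rpow_le_rpow hg0 (gaussDeriv_sq_le n y) (by linarith)
        · exact Real.rpow_le_rpow (by positivity) (sq_mul_gaussDeriv_sq_le n y) h0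
    _ = _ := by
        rw [Real.mul_rpow hF (by positivity), Real.mul_rpow hF (by positivity), mul_mul_mul_comm,
          ← Real.rpow_add' hF (by simp), ← Real.rpow_mul hn.le, ← Real.rpow_mul hn.le,
          ← Real.rpow_add hn]
        congr 1
        · simp
        · congr 1; ring

theorem one_sub_two_rpow_mul_le {H w : ℝ} (hH : 0 ≤ H) (hH1 : H ≤ 1) (hw : 0 ≤ w)
    (hw1 : w ≤ 1) :
    (1 - 2 ^ (H - 1)) * (w ^ H * (1 - w) ^ H) ≤ w ^ H + (1 - w) ^ H - 1 := by
  wlog h : w ≤ 1 / 2 generalizing w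
  · have := this (w := 1 - w) (by linarith) (by linarith) (by linarith [not_le.1 h])
    rw [sub_sub_cancel] at this
    linarith
  have h1 : 1 - w ≤ (1 - w) ^ H := by
    simpa using Real.rpow_le_rpow_of_exponent_ge' (by linarith : 0 ≤ 1 - w) (by linarith) hH hH1
  have h2 : w ≤ w ^ H * 2 ^ (H - 1) := by
    have e : w = w ^ H * w ^ (1 - H) := by
      rw [← Real.rpow_add' hw (by simp)]; simp
    have : w ^ (1 - H) ≤ 2 ^ (H - 1) := by
      rw [show (H - 1 : ℝ) = -(1 - H) by ring, Real.rpow_neg (by norm_num),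
        ← Real.inv_rpow (by norm_num)]
      exact Real.rpow_le_rpow hw (by linarith) (by linarith)
    calc w = w ^ H * w ^ (1 - H) := e
      _ ≤ _ := by gcongr
  have h3 : (2 : ℝ) ^ (H - 1) ≤ 1 := Real.rpow_le_one_of_one_le_of_nonpos (by norm_num)
    (by linarith)
  have h4 : (1 - w) ^ H ≤ 1 := Real.rpow_le_one (by linarith) (by linarith) hH
  have h5 : 0 ≤ (1 - w) ^ H := Real.rpow_nonneg (by linarith) _
  have h6 : 0 ≤ w ^ H := Real.rpow_nonneg hw _
  have h7 : (1 - 2 ^ (H - 1)) * w ^ H * (1 - w) ^ H ≤ (1 - 2 ^ (H - 1)) * w ^ H * 1 := by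
    gcongr
  linarith

theorem fbmCov_comm (H t s : ℝ) : fbmCov H t s = fbmCov H s t := by
  unfold fbmCov
  rw [abs_sub_comm]; ring

/-- The correlation of `B^H_t` and `B^H_s`. -/
noncomputable def fbmCorr (H t s : ℝ) : ℝ := fbmCov H t s * (t * s) ^ (-H)

theorem fbmCorr_comm (H t s : ℝ) : fbmCorr H t s = fbmCorr H s t := by
  rw [fbmCorr, fbmCorr, fbmCov_comm, mul_comm t]

theorem fbmCov_ge {H t s : ℝ} (hH : 0 ≤ H) (hs : 0 ≤ s) (hst : s ≤ t) :
    s ^ (2 * H) / 2 ≤ fbmCov H t s := by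
  unfold fbmCov
  have : |t - s| ^ (2 * H) ≤ t ^ (2 * H) :=
    Real.rpow_le_rpow (abs_nonneg _) (by rw [abs_of_nonneg (by linarith)]; linarith) (by linarith)
  linarith

theorem fbmCorr_nonneg {H t s : ℝ} (hH : 0 ≤ H) (ht : 0 ≤ t) (hs : 0 ≤ s) :
    0 ≤ fbmCorr H t s := by
  wlog h : s ≤ t generalizing s t
  · rw [fbmCorr_comm]; exact this hs ht (not_le.1 h).le
  exact mul_nonneg ((by positivity : (0 : ℝ) ≤ s ^ (2 * H) / 2).trans (fbmCov_ge hH hs h))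
    (by positivity)

theorem fbmCorr_le {H t s : ℝ} (hH : 0 ≤ H) (hH1 : H ≤ 1) (hs : 0 < s) (hst : s ≤ t) :
    fbmCorr H t s ≤ 1 - (1 - 2 ^ (H - 1)) / 2 * ((t - s) / t) ^ (2 * H) := by
  have ht : 0 < t := hs.trans_le hst
  obtain ⟨w, hw, hw1, rfl⟩ : ∃ w, 0 < w ∧ w ≤ 1 ∧ s = t * w :=
    ⟨s / t, by positivity, (div_le_one ht).2 hst, by field_simp⟩
  have hw' : 0 ≤ 1 - w := by linarith
  have e1 : t - t * w = t * (1 - w) := by ring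
  have e2 (a : ℝ) (ha : 0 ≤ a) : a ^ (2 * H) = (a ^ H) ^ 2 := by
    rw [mul_comm, Real.rpow_mul_natCast ha H 2 |>.symm]; norm_num
  have key := one_sub_two_rpow_mul_le hH hH1 hw.le hw1
  rw [fbmCorr, fbmCov, e1, mul_div_cancel_left₀ _ ht.ne', abs_of_nonneg (by positivity),
    e2 _ ht.le, e2 _ (by positivity), e2 _ (by positivity), e2 _ hw',
    Real.mul_rpow ht.le hw.le, Real.mul_rpow ht.le hw', Real.mul_rpow ht.le (by positivity),
    Real.mul_rpow ht.le hw.le, Real.rpow_neg ht.le, Real.rpow_neg hw.le]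
  have ha : 0 < t ^ H := by positivity
  have hb : 0 < w ^ H := by positivity
  have hc : 0 ≤ (1 - w) ^ H := by positivity
  have hb1 : w ^ H ≤ 1 := Real.rpow_le_one hw.le hw1 hH
  have hκ : 0 ≤ 1 - (2 : ℝ) ^ (H - 1) := by
    have : (2 : ℝ) ^ (H - 1) ≤ 1 := Real.rpow_le_one_of_one_le_of_nonpos (by norm_num)
      (by linarith)
    linarith
  generalize t ^ H = a at *
  generalize w ^ H = b at *
  generalize (1 - w) ^ H = c at *
  generalize 1 - (2 : ℝ) ^ (H - 1) = κ at *
  have h1 : c * (κ * (b * c)) ≤ (c + 1 - b) * (b + c - 1) :=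
    mul_le_mul (by linarith) key (by positivity) (by linarith)
  have e : (a ^ 2 + (a * b) ^ 2 - (a * c) ^ 2) / 2 * (a⁻¹ * (a⁻¹ * b⁻¹)) =
      (1 + b ^ 2 - c ^ 2) / (2 * b) := by field_simp
  rw [e, div_le_iff₀ (by positivity)]
  nlinarith

theorem rpow_mul_exp_neg_le_one {z θ : ℝ} (hz : 0 ≤ z) (h0 : 0 ≤ θ) (h1 : θ ≤ 1) :
    z ^ θ * Real.exp (-z) ≤ 1 := by
  have h : z ^ θ ≤ Real.exp z := by
    rcases le_total z 1 with h | h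
    · exact (Real.rpow_le_one hz h h0).trans (Real.one_le_exp hz)
    · calc z ^ θ ≤ z ^ (1 : ℝ) := Real.rpow_le_rpow_of_exponent_le h h1
        _ ≤ Real.exp z := by rw [Real.rpow_one]; linarith [Real.add_one_le_exp z]
  rw [Real.exp_neg, ← div_eq_mul_inv, div_le_one (Real.exp_pos _)]
  exact h

theorem pow_mul_rpow_le_of_le_one_sub {ρ κ σ θ : ℝ} (hρ : 0 ≤ ρ) (hκ : 0 ≤ κ) (hκ1 : κ ≤ 1)
    (hσ : 0 ≤ σ) (hσ1 : σ ≤ 1) (h : ρ ≤ 1 - κ * σ) (h0 : 0 ≤ θ) (h1 : θ ≤ 1) (n : ℕ) :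
    ρ ^ n * (κ * ((n + 1) * σ)) ^ θ ≤ Real.exp 1 := by
  have hz : 0 ≤ κ * ((n + 1) * σ) := by positivity
  have h2 : ρ ^ n ≤ Real.exp 1 * Real.exp (-(κ * ((n + 1) * σ))) := by
    calc ρ ^ n ≤ Real.exp (-(κ * σ)) ^ n := by
          gcongr
          linarith [Real.add_one_le_exp (-(κ * σ))]
      _ = Real.exp (κ * σ) * Real.exp (-(κ * ((n + 1) * σ))) := by
          rw [← Real.exp_nat_mul, ← Real.exp_add]; congr 1; ring
      _ ≤ _ := by
          gcongr
          exact mul_le_one₀ hκ1 hσ hσ1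
  calc _ ≤ Real.exp 1 * Real.exp (-(κ * ((n + 1) * σ))) * (κ * ((n + 1) * σ)) ^ θ := by gcongr
    _ = Real.exp 1 * ((κ * ((n + 1) * σ)) ^ θ * Real.exp (-(κ * ((n + 1) * σ)))) := by ring
    _ ≤ Real.exp 1 * 1 := by gcongr; exact rpow_mul_exp_neg_le_one hz h0 h1
    _ = _ := mul_one _

theorem gaussianKernel_mul_abs_hermiteH {H u : ℝ} (hu : 0 < u) (x : ℝ) (n : ℕ) :
    gaussianKernel (u ^ (2 * H)) x * |hermiteH n (x * u ^ (-H))| =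
      (√(2 * π))⁻¹ * (u ^ (-H) * |gaussDeriv n (x * u ^ (-H))|) / n.factorial := by
  have e1 : √(2 * π * u ^ (2 * H)) = √(2 * π) * u ^ H := by
    rw [Real.sqrt_mul (by positivity), mul_comm 2 H, Real.rpow_mul hu.le, Real.rpow_two,
      Real.sqrt_sq (by positivity)]
  have e2 : (x * u ^ (-H)) ^ 2 / 2 = x ^ 2 / (2 * u ^ (2 * H)) := by
    rw [Real.rpow_neg hu.le, mul_comm 2 H, Real.rpow_mul hu.le, Real.rpow_two]
    field_simp
  rw [gaussianKernel, hermiteH, e1, e2, abs_mul, abs_mul, abs_div, abs_pow, abs_neg, abs_one,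
    one_pow, Real.abs_exp, Nat.abs_cast, neg_div, Real.exp_neg, mul_inv, Real.rpow_neg hu.le]
  rw [← gaussDeriv]
  field_simp

/-- The integrand of the `n`-th diagonal term. -/
noncomputable def diagIntegrand (H x : ℝ) (n : ℕ) (u v : ℝ) : ℝ :=
  |u - v| ^ (2 * H - 2) * (fbmCov H u v) ^ n * (u * v) ^ (-(H * n)) *
    gaussianKernel (u ^ (2 * H)) x * gaussianKernel (v ^ (2 * H)) x *
    |hermiteH n (x * u ^ (-H)) * hermiteH n (x * v ^ (-H))|

theorem diagIntegrand_comm (H x : ℝ) (n : ℕ) (u v : ℝ) :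
    diagIntegrand H x n u v = diagIntegrand H x n v u := by
  unfold diagIntegrand
  rw [abs_sub_comm, fbmCov_comm, mul_comm u v, mul_comm (hermiteH n (x * u ^ (-H)))]
  ring

theorem diagIntegrand_eq {H u v : ℝ} (hu : 0 < u) (hv : 0 < v) (x : ℝ) (n : ℕ) :
    diagIntegrand H x n u v = (2 * π)⁻¹ / n.factorial ^ 2 *
      (|u - v| ^ (2 * H - 2) * fbmCorr H u v ^ n * (u * v) ^ (-H) *
        (|gaussDeriv n (x * u ^ (-H))| * |gaussDeriv n (x * v ^ (-H))|)) := by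
  have e : (u * v) ^ (-(H * n)) = ((u * v) ^ (-H)) ^ n := by
    rw [← Real.rpow_mul_natCast (by positivity)]; congr 1; ring
  have hs : (√(2 * π))⁻¹ * (√(2 * π))⁻¹ = (2 * π)⁻¹ := by
    rw [← mul_inv, Real.mul_self_sqrt (by positivity)]
  calc diagIntegrand H x n u v = |u - v| ^ (2 * H - 2) * fbmCorr H u v ^ n *
      ((gaussianKernel (u ^ (2 * H)) x * |hermiteH n (x * u ^ (-H))|) *
      (gaussianKernel (v ^ (2 * H)) x * |hermiteH n (x * v ^ (-H))|)) := by
        rw [diagIntegrand, fbmCorr, e, abs_mul]; ring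
    _ = _ := by
        rw [gaussianKernel_mul_abs_hermiteH hu, gaussianKernel_mul_abs_hermiteH hv, ← hs,
          Real.mul_rpow hu.le hv.le]
        ring

theorem diagIntegrand_nonneg {H u v : ℝ} (hH : 0 ≤ H) (hu : 0 < u) (hv : 0 < v) (x : ℝ)
    (n : ℕ) : 0 ≤ diagIntegrand H x n u v := by
  rw [diagIntegrand_eq hu hv]
  have := fbmCorr_nonneg hH hu.le hv.le
  positivity

theorem abs_gaussDeriv_le {H u x ε : ℝ} (hu : 0 < u) (hx : x ≠ 0) (h0 : 0 ≤ ε) (h1 : ε ≤ 1)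
    (n : ℕ) : |gaussDeriv n (x * u ^ (-H))| ≤
      √(12 * n.factorial * ((n : ℝ) + 1) ^ (ε - 1 / 2)) * (|x| ^ (-ε) * u ^ (H * ε)) := by
  have h := abs_rpow_mul_abs_gaussDeriv_le n (x * u ^ (-H)) h0 h1
  have hx' : 0 < |x| := abs_pos.2 hx
  have e : |x * u ^ (-H)| ^ ε * (|x| ^ (-ε) * u ^ (H * ε)) = 1 := by
    rw [abs_mul, abs_of_nonneg (by positivity : 0 ≤ u ^ (-H)),
      Real.mul_rpow hx'.le (by positivity), ← Real.rpow_mul hu.le, mul_mul_mul_comm,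
      ← Real.rpow_add hx', ← Real.rpow_add hu]
    simp
  calc |gaussDeriv n (x * u ^ (-H))| = |x * u ^ (-H)| ^ ε * |gaussDeriv n (x * u ^ (-H))| *
        (|x| ^ (-ε) * u ^ (H * ε)) := by
        linear_combination (-|gaussDeriv n (x * u ^ (-H))|) * e
    _ ≤ _ := by gcongr

theorem abs_sub_rpow_mul_fbmCorr_pow_le {H u v η : ℝ} (hH : 1 / 2 < H) (hH1 : H < 1)
    (hη : 0 ≤ η) (hη1 : η ≤ 2 * H - 1) (hv : 0 < v) (hvu : v < u) (n : ℕ) :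
    |u - v| ^ (2 * H - 2) * fbmCorr H u v ^ n * (u * v) ^ (η - H) ≤
      Real.exp 1 * ((1 - 2 ^ (H - 1)) / 2) ^ (-((2 * H - 1 - η) / (2 * H))) *
        ((n : ℝ) + 1) ^ (-((2 * H - 1 - η) / (2 * H))) * (|u - v| ^ (η - 1) * v ^ (η - 1)) := by
  have hu : 0 < u := hv.trans hvu
  have ht : 0 < u - v := sub_pos.2 hvu
  have hκ : 0 < 1 - (2 : ℝ) ^ (H - 1) := by
    have : (2 : ℝ) ^ (H - 1) < 1 := Real.rpow_lt_one_of_one_lt_of_neg (by norm_num) (by linarith)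
    linarith
  have hκ2 : 0 < (2 : ℝ) ^ (H - 1) := by positivity
  set κ := (1 - (2 : ℝ) ^ (H - 1)) / 2 with hκdef
  have hκ0 : 0 < κ := by positivity
  set θ := (2 * H - 1 - η) / (2 * H) with hθ
  have hθ0 : 0 ≤ θ := div_nonneg (by linarith) (by linarith)
  have hθ1 : θ ≤ 1 := (div_le_one (by linarith)).2 (by linarith)
  have hθH : 2 * H * θ = 2 * H - 1 - η := by rw [hθ]; field_simp
  set σ := ((u - v) / u) ^ (2 * H) with hσ
  have hσ0 : 0 < σ := by positivity
  have hσ1 : σ ≤ 1 := Real.rpow_le_one (by positivity) ((div_le_one hu).2 (by linarith))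
    (by linarith)
  have h1 := pow_mul_rpow_le_of_le_one_sub (fbmCorr_nonneg (by linarith) hu.le hv.le) hκ0.le
    (by linarith) hσ0.le hσ1 (fbmCorr_le (by linarith) hH1.le hv hvu.le) hθ0 hθ1 n
  have hn : (0 : ℝ) < n + 1 := by positivity
  have h2 : fbmCorr H u v ^ n ≤ Real.exp 1 * κ ^ (-θ) * ((n : ℝ) + 1) ^ (-θ) * σ ^ (-θ) := by
    have hpos : 0 < (κ * (((n : ℝ) + 1) * σ)) ^ θ := by positivity
    rw [mul_assoc, mul_assoc, ← Real.mul_rpow hn.le hσ0.le, ← Real.mul_rpow hκ0.le (by positivity),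
      Real.rpow_neg (by positivity), ← div_eq_mul_inv, le_div_iff₀ hpos]
    exact h1
  have h3 : (u - v) ^ (2 * H - 2) * σ ^ (-θ) * (u * v) ^ (η - H) =
      (u - v) ^ (η - 1) * (u ^ (H - 1) * v ^ (η - H)) := by
    rw [hσ, ← Real.rpow_mul (by positivity), mul_neg, hθH, Real.div_rpow ht.le hu.le,
      Real.mul_rpow hu.le hv.le, Real.rpow_neg hu.le, div_inv_eq_mul]
    have a1 : (u - v) ^ (η - 1) = (u - v) ^ (2 * H - 2) * (u - v) ^ (-(2 * H - 1 - η)) := by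
      rw [← Real.rpow_add ht]; congr 1; ring
    have a2 : u ^ (H - 1) = u ^ (2 * H - 1 - η) * u ^ (η - H) := by
      rw [← Real.rpow_add hu]; congr 1; ring
    rw [a1, a2]; ring
  have h4 : u ^ (H - 1) * v ^ (η - H) ≤ v ^ (η - 1) := by
    have : v ^ (η - 1) = v ^ (H - 1) * v ^ (η - H) := by
      rw [← Real.rpow_add hv]; congr 1; ring
    rw [this]
    exact mul_le_mul_of_nonneg_right
      (Real.rpow_le_rpow_of_nonpos hv hvu.le (by linarith)) (by positivity)
  rw [abs_of_pos ht]
  calc (u - v) ^ (2 * H - 2) * fbmCorr H u v ^ n * (u * v) ^ (η - H)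
      ≤ (u - v) ^ (2 * H - 2) * (Real.exp 1 * κ ^ (-θ) * ((n : ℝ) + 1) ^ (-θ) * σ ^ (-θ)) *
        (u * v) ^ (η - H) := by gcongr
    _ = Real.exp 1 * κ ^ (-θ) * ((n : ℝ) + 1) ^ (-θ) *
        ((u - v) ^ (2 * H - 2) * σ ^ (-θ) * (u * v) ^ (η - H)) := by ring
    _ = Real.exp 1 * κ ^ (-θ) * ((n : ℝ) + 1) ^ (-θ) *
        ((u - v) ^ (η - 1) * (u ^ (H - 1) * v ^ (η - H))) := by rw [h3]
    _ ≤ _ := by gcongr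

/-- For `x ≠ 0` the terms are dominated, at the polynomial rate in `n` that makes the series
converge, by a fixed kernel that is integrable on bounded sets. -/
theorem exists_factorial_mul_diagIntegrand_le {H x ε : ℝ} (hH : 1 / 2 < H) (hH1 : H < 1)
    (hx : x ≠ 0) (h0 : 0 ≤ ε) (h1 : ε ≤ 1) (hε : H * ε ≤ 2 * H - 1) :
    ∃ C : ℝ, 0 ≤ C ∧ ∀ (n : ℕ) (u v : ℝ), 0 < u → 0 < v →
      n.factorial * diagIntegrand H x n u v ≤
        C * ((n : ℝ) + 1) ^ (ε - 1 / 2 - (2 * H - 1 - H * ε) / (2 * H)) *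
          (|u - v| ^ (H * ε - 1) * (u ^ (H * ε - 1) + v ^ (H * ε - 1))) := by
  have hκ : 0 < 1 - (2 : ℝ) ^ (H - 1) := by
    have : (2 : ℝ) ^ (H - 1) < 1 := Real.rpow_lt_one_of_one_lt_of_neg (by norm_num) (by linarith)
    linarith
  have hx' : 0 < |x| := abs_pos.2 hx
  set θ := (2 * H - 1 - H * ε) / (2 * H) with hθ
  set D := Real.exp 1 * ((1 - (2 : ℝ) ^ (H - 1)) / 2) ^ (-θ) with hD
  refine ⟨(2 * π)⁻¹ * 12 * (|x| ^ (-ε)) ^ 2 * D, by positivity, fun n u v hu hv => ?_⟩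
  wlog huv : v ≤ u generalizing u v
  · rw [diagIntegrand_comm, abs_sub_comm, add_comm (u ^ (H * ε - 1))]
    exact this v u hv hu (not_le.1 huv).le
  rcases huv.eq_or_lt with rfl | hvu
  · have : (2 * H - 2 : ℝ) ≠ 0 := by linarith
    rw [diagIntegrand_eq hv hv, sub_self, abs_zero, Real.zero_rpow this]
    simp only [zero_mul, mul_zero]
    positivity
  have hη : 0 ≤ H * ε := by positivity
  have hk := abs_sub_rpow_mul_fbmCorr_pow_le hH hH1 hη hε hv hvu n
  rw [← hθ, ← hD] at hk
  have gu := abs_gaussDeriv_le (H := H) hu hx h0 h1 n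
  have gv := abs_gaussDeriv_le (H := H) hv hx h0 h1 n
  set A := 12 * n.factorial * ((n : ℝ) + 1) ^ (ε - 1 / 2) with hA
  have hA0 : 0 ≤ A := by positivity
  have hn : (0 : ℝ) < n + 1 := by positivity
  have hf : (0 : ℝ) < n.factorial := by positivity
  have hρ := fbmCorr_nonneg (H := H) (by linarith) hu.le hv.le
  have hprod : |gaussDeriv n (x * u ^ (-H))| * |gaussDeriv n (x * v ^ (-H))| ≤
      A * ((|x| ^ (-ε)) ^ 2 * (u * v) ^ (H * ε)) := by
    calc _ ≤ (√A * (|x| ^ (-ε) * u ^ (H * ε))) * (√A * (|x| ^ (-ε) * v ^ (H * ε))) := by gcongr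
      _ = (√A * √A) * ((|x| ^ (-ε)) ^ 2 * (u ^ (H * ε) * v ^ (H * ε))) := by ring
      _ = _ := by rw [Real.mul_self_sqrt hA0, Real.mul_rpow hu.le hv.le]
  have e1 : (u * v) ^ (H * ε - H) = (u * v) ^ (-H) * (u * v) ^ (H * ε) := by
    rw [← Real.rpow_add (by positivity)]; congr 1; ring
  have e2 : ((n : ℝ) + 1) ^ (ε - 1 / 2 - θ) =
      ((n : ℝ) + 1) ^ (ε - 1 / 2) * ((n : ℝ) + 1) ^ (-θ) := by
    rw [← Real.rpow_add hn]; congr 1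
  calc n.factorial * diagIntegrand H x n u v
      = (2 * π)⁻¹ / n.factorial * (|u - v| ^ (2 * H - 2) * fbmCorr H u v ^ n * (u * v) ^ (-H) *
        (|gaussDeriv n (x * u ^ (-H))| * |gaussDeriv n (x * v ^ (-H))|)) := by
        rw [diagIntegrand_eq hu hv]; field_simp
    _ ≤ (2 * π)⁻¹ / n.factorial * (|u - v| ^ (2 * H - 2) * fbmCorr H u v ^ n * (u * v) ^ (-H) *
        (A * ((|x| ^ (-ε)) ^ 2 * (u * v) ^ (H * ε)))) := by gcongr
    _ = (2 * π)⁻¹ * 12 * (|x| ^ (-ε)) ^ 2 * ((n : ℝ) + 1) ^ (ε - 1 / 2) *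
        (|u - v| ^ (2 * H - 2) * fbmCorr H u v ^ n * (u * v) ^ (H * ε - H)) := by
        rw [e1, hA]; field_simp
    _ ≤ (2 * π)⁻¹ * 12 * (|x| ^ (-ε)) ^ 2 * ((n : ℝ) + 1) ^ (ε - 1 / 2) *
        (D * ((n : ℝ) + 1) ^ (-θ) * (|u - v| ^ (H * ε - 1) * v ^ (H * ε - 1))) := by gcongr
    _ ≤ (2 * π)⁻¹ * 12 * (|x| ^ (-ε)) ^ 2 * ((n : ℝ) + 1) ^ (ε - 1 / 2) *
        (D * ((n : ℝ) + 1) ^ (-θ) *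
          (|u - v| ^ (H * ε - 1) * (u ^ (H * ε - 1) + v ^ (H * ε - 1)))) := by
        gcongr
        exact le_add_of_nonneg_left (by positivity)
    _ = _ := by rw [e2]; ring

theorem intervalIntegrable_abs_rpow {a : ℝ} (ha : -1 < a) (b c : ℝ) :
    IntervalIntegrable (fun t : ℝ => |t| ^ a) volume b c := by
  have h (y : ℝ) (hy : 0 ≤ y) : IntervalIntegrable (fun t : ℝ => |t| ^ a) volume 0 y := by
    refine (intervalIntegral.intervalIntegrable_rpow' ha).congr fun t ht => ?_
    rw [Set.uIoc_of_le hy] at ht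
    simp only [abs_of_pos ht.1]
  have h' (y : ℝ) : IntervalIntegrable (fun t : ℝ => |t| ^ a) volume 0 y := by
    rcases le_total 0 y with hy | hy
    · exact h y hy
    · rw [IntervalIntegrable.iff_comp_neg]
      simpa using h (-y) (by linarith)
  exact (h' b).symm.trans (h' c)

theorem integrable_abs_sub_rpow_mul_add {a T : ℝ} (ha : -1 < a) (hT : 0 ≤ T) :
    Integrable (fun p : ℝ × ℝ => |p.1 - p.2| ^ a * (p.1 ^ a + p.2 ^ a))
      ((volume.restrict (Set.Ioc 0 T)).prod (volume.restrict (Set.Ioc 0 T))) := by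
  have hf : Integrable ((Set.Ioc 0 T).indicator fun t : ℝ => t ^ a) := by
    rw [integrable_indicator_iff measurableSet_Ioc]
    exact (intervalIntegrable_iff_integrableOn_Ioc_of_le hT).1
      (intervalIntegral.intervalIntegrable_rpow' ha)
  have hg : Integrable ((Set.Ioc (-T) T).indicator fun t : ℝ => |t| ^ a) := by
    rw [integrable_indicator_iff measurableSet_Ioc]
    exact (intervalIntegrable_iff_integrableOn_Ioc_of_le (by linarith)).1
      (intervalIntegrable_abs_rpow ha _ _)
  have h2 : Integrable (fun p : ℝ × ℝ => |p.1 - p.2| ^ a * p.2 ^ a)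
      ((volume.restrict (Set.Ioc 0 T)).prod (volume.restrict (Set.Ioc 0 T))) := by
    rw [Measure.prod_restrict]
    refine ((hf.convolution_integrand (ContinuousLinearMap.mul ℝ ℝ) hg).integrableOn
      (s := Set.Ioc 0 T ×ˢ Set.Ioc 0 T)).congr_fun (fun p hp => ?_)
      (measurableSet_Ioc.prod measurableSet_Ioc)
    obtain ⟨⟨h1, h2⟩, h3⟩ := hp
    have h4 : p.1 - p.2 ∈ Set.Ioc (-T) T := ⟨by linarith [h3.2], by linarith [h3.1]⟩
    simp only [ContinuousLinearMap.mul_apply', Set.indicator_of_mem h3, Set.indicator_of_mem h4]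
    ring
  refine (h2.swap.add h2).congr (.of_forall fun p => ?_)
  simp only [Pi.add_apply, Function.comp_apply, Prod.fst_swap, Prod.snd_swap]
  rw [abs_sub_comm p.2]; ring

theorem integral_diagIntegrand_le {H T x C a : ℝ} {n : ℕ} (hH : 0 ≤ H) (hT : 0 ≤ T)
    (ha : -1 < a)
    (h : ∀ u v : ℝ, 0 < u → 0 < v →
      diagIntegrand H x n u v ≤ C * (|u - v| ^ a * (u ^ a + v ^ a))) :
    ∫ u in (0 : ℝ)..T, ∫ v in (0 : ℝ)..T, diagIntegrand H x n u v ≤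
      C * ∫ u in (0 : ℝ)..T, ∫ v in (0 : ℝ)..T, |u - v| ^ a * (u ^ a + v ^ a) := by
  have hK := (integrable_abs_sub_rpow_mul_add ha hT).const_mul C
  simp only [intervalIntegral.integral_of_le hT, ← integral_const_mul]
  refine integral_mono_of_nonneg ?_ hK.integral_prod_left ?_
  · filter_upwards [ae_restrict_mem measurableSet_Ioc] with u hu
    exact setIntegral_nonneg measurableSet_Ioc fun v hv =>
      diagIntegrand_nonneg hH hu.1 hv.1 x n
  · filter_upwards [ae_restrict_mem measurableSet_Ioc, hK.prod_right_ae] with u hu hKu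
    refine integral_mono_of_nonneg ?_ hKu ?_
    · filter_upwards [ae_restrict_mem measurableSet_Ioc] with v hv
      exact diagIntegrand_nonneg hH hu.1 hv.1 x n
    · filter_upwards [ae_restrict_mem measurableSet_Ioc] with v hv
      exact h u v hu.1 hv.1

theorem diagIntegrand_zero_eq {H u v : ℝ} (hu : 0 < u) (hv : 0 < v) (n : ℕ) :
    diagIntegrand H 0 n u v = (2 * π)⁻¹ / n.factorial ^ 2 * gaussDeriv n 0 ^ 2 *
      (|u - v| ^ (2 * H - 2) * fbmCorr H u v ^ n * (u * v) ^ (-H)) := by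
  rw [diagIntegrand_eq hu hv, zero_mul, zero_mul, abs_mul_abs_self]; ring

theorem fbmCorr_le_one {H t s : ℝ} (hH : 0 ≤ H) (hH1 : H ≤ 1) (ht : 0 < t) (hs : 0 < s) :
    fbmCorr H t s ≤ 1 := by
  wlog h : s ≤ t generalizing s t
  · rw [fbmCorr_comm]; exact this hs ht (not_le.1 h).le
  have h1 : (2 : ℝ) ^ (H - 1) ≤ 1 := Real.rpow_le_one_of_one_le_of_nonpos (by norm_num)
    (by linarith)
  have h2 : 0 ≤ (t - s) / t := div_nonneg (by linarith) ht.le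
  have h3 : 0 ≤ (1 - (2 : ℝ) ^ (H - 1)) / 2 * ((t - s) / t) ^ (2 * H) :=
    mul_nonneg (by linarith) (by positivity)
  linarith [fbmCorr_le hH hH1 hs h]

theorem integrableOn_diagIntegrand_zero {H T u : ℝ} (hH : 1 / 2 < H) (hH1 : H < 1)
    (hT : 0 ≤ T) (hu : 0 < u) (n : ℕ) :
    IntegrableOn (diagIntegrand H 0 n u) (Set.Ioc 0 T) := by
  have hu2 : 0 < u / 2 := by positivity
  have i1 : IntegrableOn (fun v : ℝ => v ^ (-H)) (Set.Ioc 0 T) :=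
    (intervalIntegrable_iff_integrableOn_Ioc_of_le hT).1
      (intervalIntegral.intervalIntegrable_rpow' (by linarith))
  have i2 : IntegrableOn (fun v : ℝ => |u - v| ^ (2 * H - 2)) (Set.Ioc 0 T) := by
    have := (intervalIntegrable_abs_rpow (by linarith : -1 < 2 * H - 2) u (u - T)).comp_sub_left u
    rw [sub_self, sub_sub_cancel] at this
    exact (intervalIntegrable_iff_integrableOn_Ioc_of_le hT).1 this
  have hmeas : Measurable (diagIntegrand H 0 n u) := by
    unfold diagIntegrand fbmCov gaussianKernel
    simp only [zero_mul]
    fun_prop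
  set c := (2 * π)⁻¹ / n.factorial ^ 2 * gaussDeriv n 0 ^ 2 with hc
  have hc0 : 0 ≤ c := by positivity
  refine Integrable.mono' (((i1.const_mul ((u / 2) ^ (2 * H - 2))).add
    (i2.const_mul ((u / 2) ^ (-H)))).const_mul (c * u ^ (-H))) hmeas.aestronglyMeasurable ?_
  filter_upwards [ae_restrict_mem measurableSet_Ioc] with v hv
  have hv0 : 0 < v := hv.1
  rw [Real.norm_of_nonneg (diagIntegrand_nonneg (by linarith) hu hv0 0 n),
    diagIntegrand_zero_eq hu hv0, ← hc]
  have hρ := fbmCorr_nonneg (H := H) (by linarith) hu.le hv0.le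
  have h1 : fbmCorr H u v ^ n ≤ 1 :=
    pow_le_one₀ hρ (fbmCorr_le_one (by linarith) hH1.le hu hv0)
  have h2 : |u - v| ^ (2 * H - 2) * v ^ (-H) ≤
      (u / 2) ^ (2 * H - 2) * v ^ (-H) + (u / 2) ^ (-H) * |u - v| ^ (2 * H - 2) := by
    rcases le_total v (u / 2) with h | h
    · have : |u - v| ^ (2 * H - 2) ≤ (u / 2) ^ (2 * H - 2) :=
        Real.rpow_le_rpow_of_nonpos hu2 ((by linarith : u / 2 ≤ u - v).trans (le_abs_self _))
          (by linarith)
      exact le_add_of_le_of_nonneg (by gcongr) (by positivity)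
    · have : v ^ (-H) ≤ (u / 2) ^ (-H) := Real.rpow_le_rpow_of_nonpos hu2 h (by linarith)
      rw [mul_comm]
      exact le_add_of_nonneg_of_le (by positivity) (by gcongr)
  calc c * (|u - v| ^ (2 * H - 2) * fbmCorr H u v ^ n * (u * v) ^ (-H))
      ≤ c * (|u - v| ^ (2 * H - 2) * 1 * (u * v) ^ (-H)) := by gcongr
    _ = c * u ^ (-H) * (|u - v| ^ (2 * H - 2) * v ^ (-H)) := by
        rw [Real.mul_rpow hu.le hv0.le]; ring
    _ ≤ _ := by
        simp only [Pi.add_apply]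
        gcongr

theorem diagIntegrand_zero_ge {H u v : ℝ} (hH : 0 ≤ H) (hH1 : H ≤ 1) (hu : 0 < u)
    (hv : u / 2 < v) (hvu : v < u) (n : ℕ) :
    (2 * π)⁻¹ / n.factorial ^ 2 * gaussDeriv n 0 ^ 2 * ((1 / 2) ^ (2 * H) / 2) ^ n *
      (u⁻¹ * u⁻¹) ≤ diagIntegrand H 0 n u v := by
  have hv0 : 0 < v := by linarith
  have ht : 0 < u - v := by linarith
  have hu2 : (u * u) ^ (-H) = u ^ (-(2 * H)) := by
    rw [Real.mul_rpow hu.le hu.le, ← Real.rpow_add hu]; congr 1; ring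
  have h1 : u ^ (2 * H - 2) ≤ |u - v| ^ (2 * H - 2) := by
    rw [abs_of_pos ht]
    exact Real.rpow_le_rpow_of_nonpos ht (by linarith) (by linarith)
  have h2 : u ^ (-(2 * H)) ≤ (u * v) ^ (-H) := by
    rw [← hu2]
    exact Real.rpow_le_rpow_of_nonpos (by positivity) (by gcongr) (by linarith)
  have h3 : (1 / 2 : ℝ) ^ (2 * H) / 2 ≤ fbmCorr H u v := by
    calc (1 / 2 : ℝ) ^ (2 * H) / 2 = (u * (1 / 2)) ^ (2 * H) / 2 * u ^ (-(2 * H)) := by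
          rw [Real.mul_rpow hu.le (by norm_num), Real.rpow_neg hu.le]; field_simp
      _ ≤ v ^ (2 * H) / 2 * u ^ (-(2 * H)) := by
          gcongr; linarith
      _ ≤ fbmCorr H u v := by
          unfold fbmCorr
          exact mul_le_mul (fbmCov_ge hH hv0.le hvu.le) h2 (by positivity)
            ((by positivity : (0 : ℝ) ≤ v ^ (2 * H) / 2).trans (fbmCov_ge hH hv0.le hvu.le))
  have e : u⁻¹ * u⁻¹ = u ^ (2 * H - 2) * u ^ (-(2 * H)) := by
    rw [← Real.rpow_add hu, ← Real.rpow_neg_one, ← Real.rpow_add hu]; congr 1; ring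
  have hρ := fbmCorr_nonneg (H := H) hH hu.le hv0.le
  rw [diagIntegrand_zero_eq hu hv0, e, mul_assoc]
  gcongr ?_ * ?_
  calc _ = u ^ (2 * H - 2) * ((1 / 2 : ℝ) ^ (2 * H) / 2) ^ n * u ^ (-(2 * H)) := by ring
    _ ≤ _ := by gcongr

/-- At `x = 0` the outer integrand is either zero or of order `1 / u` at the origin, hence not
integrable, so that the Bochner integral takes its default value. -/
theorem integral_diagIntegrand_zero {H T : ℝ} (hH : 1 / 2 < H) (hH1 : H < 1) (hT : 0 < T)
    (n : ℕ) : ∫ u in (0 : ℝ)..T, ∫ v in (0 : ℝ)..T, diagIntegrand H 0 n u v = 0 := by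
  by_cases h0 : gaussDeriv n 0 = 0
  · simp only [intervalIntegral.integral_of_le hT.le]
    refine setIntegral_eq_zero_of_forall_eq_zero fun u hu =>
      setIntegral_eq_zero_of_forall_eq_zero fun v hv => ?_
    rw [diagIntegrand_zero_eq hu.1 hv.1, h0]
    ring
  refine intervalIntegral.integral_undef fun hKu => ?_
  set c := (2 * π)⁻¹ / n.factorial ^ 2 * gaussDeriv n 0 ^ 2 * ((1 / 2) ^ (2 * H) / 2) ^ n
    with hc
  have hc0 : 0 < c := by positivity
  have hlow : ∀ u ∈ Set.Ioc 0 T, c / 2 * u⁻¹ ≤ ∫ v in (0 : ℝ)..T, diagIntegrand H 0 n u v := by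
    intro u hu
    have hu0 : 0 < u := hu.1
    have hI := integrableOn_diagIntegrand_zero hH hH1 hT.le hu0 n
    have hsub : Set.Ioo (u / 2) u ⊆ Set.Ioc 0 T := fun v hv =>
      ⟨by linarith [hv.1], by linarith [hv.2, hu.2]⟩
    rw [intervalIntegral.integral_of_le hT.le]
    calc c / 2 * u⁻¹ = ∫ _ in Set.Ioo (u / 2) u, c * (u⁻¹ * u⁻¹) := by
          rw [setIntegral_const, measureReal_def, Real.volume_Ioo,
            ENNReal.toReal_ofReal (by linarith), smul_eq_mul]
          field_simp; ring
      _ ≤ ∫ v in Set.Ioo (u / 2) u, diagIntegrand H 0 n u v := by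
          refine setIntegral_mono_on (integrableOn_const (by simp)) (hI.mono_set hsub)
            measurableSet_Ioo fun v hv => ?_
          exact diagIntegrand_zero_ge (by linarith) hH1.le hu0 hv.1 hv.2 n
      _ ≤ _ := by
          refine setIntegral_mono_set hI ?_ hsub.eventuallyLE
          filter_upwards [ae_restrict_mem measurableSet_Ioc] with v hv
          exact diagIntegrand_nonneg (by linarith) hu0 hv.1 0 n
  have hinv : IntervalIntegrable (fun u : ℝ => u⁻¹) volume 0 T := by
    rw [intervalIntegrable_iff_integrableOn_Ioc_of_le hT.le] at hKu ⊢
    refine Integrable.mono' (hKu.const_mul (c / 2)⁻¹)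
      measurable_inv.aestronglyMeasurable ?_
    filter_upwards [ae_restrict_mem measurableSet_Ioc] with u hu
    have hu0 : 0 < u := hu.1
    rw [Real.norm_of_nonneg (by positivity), ← div_eq_inv_mul, le_div_iff₀ (by positivity),
      mul_comm]
    exact hlow u hu
  rcases intervalIntegrable_inv_iff.1 hinv with h | h
  · exact hT.ne h
  · exact h Set.left_mem_uIcc

/-- for `H ∈ (1/2,1)`, `T > 0`, `x ∈ ℝ` and `α < 1/2 − 1/(2H)`, the series
`∑_n (n+2)^α n! ∫_0^T ∫_0^T |u−v|^{2H−2} R(u,v)^n (uv)^{−Hn}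
  p_{u^{2H}}(x) p_{v^{2H}}(x) |H_n(x u^{−H}) H_n(x v^{−H})| du dv` converges. -/
theorem fbm_current_watanabe_diagonal_summable
    (H T x α : ℝ) (hH : 1 / 2 < H) (hH1 : H < 1) (hT : 0 < T)
    (hα : α < 1 / 2 - 1 / (2 * H)) :
    Summable (fun n : ℕ => ((n : ℝ) + 2) ^ α * (n.factorial : ℝ) *
      ∫ u in (0 : ℝ)..T, ∫ v in (0 : ℝ)..T,
        |u - v| ^ (2 * H - 2) * (fbmCov H u v) ^ n * (u * v) ^ (-(H * n)) *
          gaussianKernel (u ^ (2 * H)) x * gaussianKernel (v ^ (2 * H)) x *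
          |hermiteH n (x * u ^ (-H)) * hermiteH n (x * v ^ (-H))|) := by
  change Summable (fun n : ℕ => ((n : ℝ) + 2) ^ α * (n.factorial : ℝ) *
    ∫ u in (0 : ℝ)..T, ∫ v in (0 : ℝ)..T, diagIntegrand H x n u v)
  rcases eq_or_ne x 0 with rfl | hx
  · simp only [integral_diagIntegrand_zero hH hH1 hT, mul_zero]
    exact summable_zero
  have hH0 : 0 < H := by linarith
  obtain ⟨ε, hε0, hεH, hεα⟩ : ∃ ε : ℝ, 0 < ε ∧ H * ε ≤ 2 * H - 1 ∧
      3 / 2 * ε < 1 / 2 - 1 / (2 * H) - α := by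
    refine ⟨min ((2 * H - 1) / H) ((1 / 2 - 1 / (2 * H) - α) / 3),
      lt_min (div_pos (by linarith) hH0) (by linarith), ?_, ?_⟩
    · calc _ ≤ H * ((2 * H - 1) / H) := by gcongr; exact min_le_left _ _
        _ = _ := by field_simp
    · have := min_le_right ((2 * H - 1) / H) ((1 / 2 - 1 / (2 * H) - α) / 3)
      linarith
  have hε1 : ε ≤ 1 := by nlinarith
  obtain ⟨C, hC, hbound⟩ := exists_factorial_mul_diagIntegrand_le hH hH1 hx hε0.le hε1 hεH
  set e := ε - 1 / 2 - (2 * H - 1 - H * ε) / (2 * H) with he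
  set I := ∫ u in (0 : ℝ)..T, ∫ v in (0 : ℝ)..T,
    |u - v| ^ (H * ε - 1) * (u ^ (H * ε - 1) + v ^ (H * ε - 1)) with hI
  have hα0 : α ≤ 0 := by
    have : 1 / 2 ≤ 1 / (2 * H) := one_div_le_one_div_of_le (by linarith) (by linarith)
    linarith
  have hαe : α + e < -1 := by
    have : (2 * H - 1 - H * ε) / (2 * H) = 1 - 1 / (2 * H) - ε / 2 := by field_simp
    rw [he, this]
    linarith
  have hsum : Summable fun n : ℕ => ((n : ℝ) + 1) ^ (α + e) * (C * I) := by
    have := (summable_nat_add_iff 1).2 (Real.summable_nat_rpow.2 hαe)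
    push_cast at this
    exact this.mul_right _
  have hnonneg (n : ℕ) :
      0 ≤ ∫ u in (0 : ℝ)..T, ∫ v in (0 : ℝ)..T, diagIntegrand H x n u v := by
    simp only [intervalIntegral.integral_of_le hT.le]
    exact setIntegral_nonneg measurableSet_Ioc fun u hu =>
      setIntegral_nonneg measurableSet_Ioc fun v hv =>
        diagIntegrand_nonneg hH0.le hu.1 hv.1 x n
  refine Summable.of_nonneg_of_le (fun n => mul_nonneg (by positivity) (hnonneg n))
    (fun n => ?_) hsum
  have hn : (0 : ℝ) < n + 1 := by positivity
  have hf : (0 : ℝ) < n.factorial := by positivity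
  have hle : ∫ u in (0 : ℝ)..T, ∫ v in (0 : ℝ)..T, diagIntegrand H x n u v ≤
      C * ((n : ℝ) + 1) ^ e / n.factorial * I := by
    refine integral_diagIntegrand_le hH0.le hT.le (by linarith [mul_pos hH0 hε0])
      fun u v hu hv => ?_
    rw [div_mul_eq_mul_div, le_div_iff₀ hf, mul_comm]
    exact hbound n u v hu hv
  have hle' : (n.factorial : ℝ) *
      ∫ u in (0 : ℝ)..T, ∫ v in (0 : ℝ)..T, diagIntegrand H x n u v ≤
      ((n : ℝ) + 1) ^ e * (C * I) := by
    calc _ ≤ (n.factorial : ℝ) * (C * ((n : ℝ) + 1) ^ e / n.factorial * I) := by gcongr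
      _ = _ := by field_simp
  have hpow : ((n : ℝ) + 2) ^ α ≤ ((n : ℝ) + 1) ^ α :=
    Real.rpow_le_rpow_of_nonpos hn (by linarith) hα0
  rw [mul_assoc, Real.rpow_add hn, mul_assoc]
  exact mul_le_mul hpow hle' (mul_nonneg hf.le (hnonneg n)) (by positivity)
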